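/- arXiv:1608.01405 — 3 statements merged into one kernel-verified Lean document; each statement's English description precedes it below -/
import Mathlib

section
/- The map μ+(x) = 1 − x⁺ is a measurement for ⊑L+, i.e. a strictly monotone map into [0,∞) with the reversed order: if x ⊑L+ y then x⁺ ≤ y⁺ (so μ+(x) ≥ μ+(y)), and if moreover x⁺ = y⁺ then x = y. -/
/-- `x` is a point of the probability simplex `Δⁿ`. -/
def IsDist {n : ℕ} (x : Fin n → ℝ) : Prop :=
  (∀ k, 0 ≤ x k) ∧ ∑ k, x k = 1

/-- `x⁺`, the largest coordinate of `x`. -/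
noncomputable def maxCoord {n : ℕ} (x : Fin n → ℝ) : ℝ :=
  sSup (Set.range x)

/-- The renormalised Löwner order `⊑L+`: `x ⊑L+ y` iff `x⁺ · y_k ≤ y⁺ · x_k` for all `k`. -/
def LowPlus {n : ℕ} (x y : Fin n → ℝ) : Prop :=
  ∀ k, maxCoord x * y k ≤ maxCoord y * x k

theorem IsDist.le_one {n : ℕ} {x : Fin n → ℝ} (hx : IsDist x) (k : Fin n) : x k ≤ 1 :=
  hx.2 ▸ Finset.single_le_sum (fun i _ => hx.1 i) (Finset.mem_univ k)

theorem maxCoord_le_one {n : ℕ} {x : Fin n → ℝ} (hx : IsDist x) : maxCoord x ≤ 1 :=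
  Real.sSup_le (Set.forall_mem_range.2 hx.le_one) zero_le_one

theorem le_maxCoord {n : ℕ} (x : Fin n → ℝ) (k : Fin n) : x k ≤ maxCoord x :=
  le_csSup (Set.finite_range x).bddAbove ⟨k, rfl⟩

theorem maxCoord_pos {n : ℕ} {x : Fin n → ℝ} (hx : IsDist x) : 0 < maxCoord x := by
  by_contra! h
  have : ∑ k, x k ≤ 0 := Finset.sum_nonpos fun k _ => (le_maxCoord x k).trans h
  linarith [hx.2]

theorem LowPlus.maxCoord_le {n : ℕ} {x y : Fin n → ℝ} (hx : IsDist x) (hy : IsDist y)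
    (h : LowPlus x y) : maxCoord x ≤ maxCoord y := by
  have := Finset.sum_le_sum fun k (_ : k ∈ Finset.univ) => h k
  simpa [← Finset.mul_sum, hx.2, hy.2] using this

theorem LowPlus.eq_of_maxCoord_eq {n : ℕ} {x y : Fin n → ℝ} (hx : IsDist x) (hy : IsDist y)
    (h : LowPlus x y) (hxy : maxCoord x = maxCoord y) : x = y := by
  have hle : ∀ k ∈ Finset.univ, y k ≤ x k := fun k _ =>
    le_of_mul_le_mul_left (hxy ▸ h k) (maxCoord_pos hy)
  have := (Finset.sum_eq_sum_iff_of_le hle).1 (hy.2.trans hx.2.symm)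
  exact funext fun k => (this k (Finset.mem_univ k)).symm

/-- `μ₊(x) = 1 − x⁺` is a measurement for `⊑L+`: it maps into `[0,∞)`, is monotone into the
reversed order (`x ⊑L+ y` implies `x⁺ ≤ y⁺`, i.e. `μ₊(x) ≥ μ₊(y)`), and is strict
(`x ⊑L+ y` and `x⁺ = y⁺` imply `x = y`). -/
theorem muPlus_measurement (n : ℕ) (hn : 2 ≤ n) :
    (∀ x : Fin n → ℝ, IsDist x → 0 ≤ 1 - maxCoord x) ∧
    (∀ x y : Fin n → ℝ, IsDist x → IsDist y → LowPlus x y →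
      maxCoord x ≤ maxCoord y ∧ 1 - maxCoord y ≤ 1 - maxCoord x) ∧
    (∀ x y : Fin n → ℝ, IsDist x → IsDist y → LowPlus x y →
      maxCoord x = maxCoord y → x = y) := by
  exact ⟨fun x hx => sub_nonneg.2 (maxCoord_le_one hx),
    fun x y hx hy h => ⟨h.maxCoord_le hx hy, sub_le_sub_left (h.maxCoord_le hx hy) 1⟩,
    fun x y hx hy h => h.eq_of_maxCoord_eq hx hy⟩
end

section
/- The partial order ⊑L− is an information ordering on Δⁿ: (i) it is permutation invariant, i.e. x ⊑L− y implies σ(x) ⊑L− σ(y) for every permutation σ of coordinates; (ii) it allows mixing, i.e. x ⊑L− y implies x ⊑L− (1−t)x + ty ⊑L− y for all t ∈ [0,1]; (iii) the uniform distribution ⊥ = (1/n,…,1/n) satisfies ⊥ ⊑L− x for every x ∈ Δⁿ; (iv) every x ∈ Δⁿ satisfies x ⊑L− ⊤_i for some i, where ⊤_i is the pointed distribution with i-th coordinate 1 and the others 0, and each ⊤_i is maximal (⊤_i ⊑L− y implies y = ⊤_i). -/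
/-- `x⁻`, the smallest nonzero coordinate of `x`. -/
noncomputable def minPos {n : ℕ} (x : Fin n → ℝ) : ℝ :=
  sInf {a : ℝ | (∃ k, x k = a) ∧ a ≠ 0}

/-- The renormalised Löwner order `⊑L−`: `x ⊑L− y` iff the zero set of `x` is contained in
that of `y`, and either some coordinate where `y` vanishes carries the smallest nonzero
coordinate of `x`, or the zero sets coincide and `x_k · y⁻ ≤ y_k · x⁻` for all `k` with
`x_k ≠ 0`. -/
def LowMinus {n : ℕ} (x y : Fin n → ℝ) : Prop :=
  {k | x k = 0} ⊆ {k | y k = 0} ∧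
  ((∃ k, y k = 0 ∧ x k = minPos x) ∨
   ({k | x k = 0} = {k | y k = 0} ∧
     ∀ k, x k ≠ 0 → x k * minPos y ≤ y k * minPos x))

theorem minPos_comp_perm {n : ℕ} (x : Fin n → ℝ) (σ : Equiv.Perm (Fin n)) :
    minPos (x ∘ σ) = minPos x := by
  unfold minPos
  congr 1
  ext a
  simp only [Set.mem_ofPred_eq, Function.comp_apply]
  rw [σ.surjective.exists (p := fun k => x k = a)]

theorem minPos_eq_of_forall_le {n : ℕ} {x : Fin n → ℝ} {k : Fin n} (hk : x k ≠ 0)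
    (h : ∀ j, x j ≠ 0 → x k ≤ x j) : minPos x = x k := by
  refine IsLeast.csInf_eq ⟨⟨⟨k, rfl⟩, hk⟩, ?_⟩
  rintro a ⟨⟨j, rfl⟩, hj⟩
  exact h j hj

theorem IsDist.exists_minPos_eq {n : ℕ} {x : Fin n → ℝ} (hx : IsDist x) :
    ∃ k, 0 < x k ∧ minPos x = x k ∧ ∀ j, x j ≠ 0 → x k ≤ x j := by
  have hne : (Finset.univ.filter fun k => x k ≠ 0).Nonempty := by
    by_contra hempty
    have hzero : ∀ k, x k = 0 := by
      simpa [Finset.not_nonempty_iff_eq_empty, Finset.filter_eq_empty_iff] using hempty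
    have := hx.2
    simp [hzero] at this
  obtain ⟨k, hk, hmin⟩ := Finset.exists_min_image _ x hne
  have hk0 : x k ≠ 0 := (Finset.mem_filter.mp hk).2
  have hle : ∀ j, x j ≠ 0 → x k ≤ x j := fun j hj => hmin j (by simp [hj])
  exact ⟨k, lt_of_le_of_ne (hx.1 k) hk0.symm, minPos_eq_of_forall_le hk0 hle, hle⟩

theorem LowMinus.refl {n : ℕ} (x : Fin n → ℝ) : LowMinus x x :=
  ⟨subset_rfl, Or.inr ⟨rfl, fun _ _ => le_rfl⟩⟩

theorem LowMinus.comp_perm {n : ℕ} {x y : Fin n → ℝ} (h : LowMinus x y)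
    (σ : Equiv.Perm (Fin n)) : LowMinus (x ∘ σ) (y ∘ σ) := by
  obtain ⟨hsub, hcase⟩ := h
  refine ⟨fun k hk => hsub hk, ?_⟩
  rw [minPos_comp_perm, minPos_comp_perm]
  rcases hcase with ⟨k, hyk, hxk⟩ | ⟨heq, hle⟩
  · exact Or.inl ⟨σ.symm k, by simpa using hyk, by simpa using hxk⟩
  · refine Or.inr ⟨?_, fun k hk => hle (σ k) hk⟩
    ext k
    exact Set.ext_iff.mp heq (σ k)

theorem LowMinus.mix {n : ℕ} {x y : Fin n → ℝ} (hx : IsDist x) (hy : IsDist y)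
    (h : LowMinus x y) {t : ℝ} (ht : t ∈ Set.Icc (0 : ℝ) 1) :
    LowMinus x (fun k => (1 - t) * x k + t * y k) ∧
      LowMinus (fun k => (1 - t) * x k + t * y k) y := by
  obtain ⟨ht0, ht1⟩ := ht
  rcases eq_or_lt_of_le ht1 with rfl | ht1
  · simpa using And.intro h (LowMinus.refl y)
  have hs : 0 < 1 - t := by linarith
  obtain ⟨hsub, hcase⟩ := h
  have hzero : ∀ k, (1 - t) * x k + t * y k = 0 ↔ x k = 0 := by
    intro k
    constructor
    · intro hk
      have h1 := mul_nonneg hs.le (hx.1 k)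
      have h2 := mul_nonneg ht0 (hy.1 k)
      have h3 : (1 - t) * x k = 0 := by linarith
      exact (mul_eq_zero.mp h3).resolve_left hs.ne'
    · intro hk
      have hyk : y k = 0 := hsub hk
      simp [hk, hyk]
  have hset : {k | x k = 0} = {k | (1 - t) * x k + t * y k = 0} :=
    Set.ext fun k => (hzero k).symm
  obtain ⟨p, hp, hpx, hpmin⟩ := hx.exists_minPos_eq
  rcases hcase with ⟨k, hyk, hxk⟩ | ⟨heq, hle⟩
  · have hxp : x k = x p := hxk.trans hpx
    have hmin : minPos (fun k => (1 - t) * x k + t * y k) = (1 - t) * x k + t * y k := by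
      refine minPos_eq_of_forall_le (k := k) (by rw [Ne, hzero, hxp]; exact hp.ne') ?_
      intro j hj
      rw [Ne, hzero] at hj
      have h1 := mul_le_mul_of_nonneg_left (hpmin j hj) hs.le
      have h2 := mul_nonneg ht0 (hy.1 j)
      rw [hyk, hxp]
      linarith
    refine ⟨⟨hset.subset, Or.inr ⟨hset, fun j _ => ?_⟩⟩,
      ⟨hset.symm.subset.trans hsub, Or.inl ⟨k, hyk, hmin.symm⟩⟩⟩
    rw [hmin, hpx, hxp, hyk]
    nlinarith [mul_nonneg (mul_nonneg ht0 (hy.1 j)) hp.le]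
  · obtain ⟨q, hq, hqy, hqmin⟩ := hy.exists_minPos_eq
    have hiff : ∀ k, x k = 0 ↔ y k = 0 := fun k => Set.ext_iff.mp heq k
    rw [hpx, hqy] at hle
    have hxq0 : x q ≠ 0 := by rw [Ne, hiff]; exact hq.ne'
    have hxq : x q = x p :=
      le_antisymm (le_of_mul_le_mul_right (by linarith [hle q hxq0]) hq) (hpmin q hxq0)
    have hmin : minPos (fun k => (1 - t) * x k + t * y k) = (1 - t) * x q + t * y q := by
      refine minPos_eq_of_forall_le (k := q) (by rwa [Ne, hzero]) ?_
      intro j hj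
      rw [Ne, hzero] at hj
      rw [hxq]
      exact add_le_add (mul_le_mul_of_nonneg_left (hpmin j hj) hs.le)
        (mul_le_mul_of_nonneg_left (hqmin j (by rwa [Ne, ← hiff])) ht0)
    refine ⟨⟨hset.subset, Or.inr ⟨hset, fun j hj => ?_⟩⟩,
      ⟨hset.symm.subset.trans hsub, Or.inr ⟨hset.symm.trans heq, fun j hj => ?_⟩⟩⟩
    · rw [hmin, hpx, hxq]
      nlinarith [mul_le_mul_of_nonneg_left (hle j hj) ht0]
    · rw [Ne, hzero] at hj
      rw [hmin, hqy, hxq]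
      nlinarith [mul_le_mul_of_nonneg_left (hle j hj) hs.le]

theorem lowMinus_const {n : ℕ} {c : ℝ} (hc : 0 < c) {x : Fin n → ℝ} (hx : IsDist x) :
    LowMinus (fun _ => c) x := by
  obtain ⟨p, -, hpx, hpmin⟩ := hx.exists_minPos_eq
  have hmin : minPos (fun _ : Fin n => c) = c :=
    minPos_eq_of_forall_le (k := p) hc.ne' fun _ _ => le_rfl
  refine ⟨fun k hk => absurd hk hc.ne', ?_⟩
  by_cases h : ∃ k, x k = 0
  · obtain ⟨k, hk⟩ := h
    exact Or.inl ⟨k, hk, hmin.symm⟩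
  · push Not at h
    refine Or.inr ⟨?_, fun k _ => ?_⟩
    · ext k
      simp [hc.ne', h k]
    · rw [hmin, hpx, mul_comm]
      exact mul_le_mul_of_nonneg_right (hpmin k (h k)) hc.le

theorem IsDist.eq_ite_of_forall_ne {n : ℕ} {x : Fin n → ℝ} (hx : IsDist x) {i : Fin n}
    (h : ∀ j, j ≠ i → x j = 0) : x = fun k => if k = i then (1 : ℝ) else 0 := by
  have hi : x i = 1 := by
    rw [← hx.2]
    exact (Finset.sum_eq_single i (fun j _ hj => h j hj) (by simp)).symm
  ext k
  by_cases hk : k = i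
  · simp [hk, hi]
  · simp [hk, h k hk]

theorem IsDist.exists_lowMinus_ite {n : ℕ} {x : Fin n → ℝ} (hx : IsDist x) :
    ∃ i : Fin n, LowMinus x (fun k => if k = i then (1 : ℝ) else 0) := by
  obtain ⟨p, -, hpx, -⟩ := hx.exists_minPos_eq
  by_cases h : ∃ i, i ≠ p ∧ x i ≠ 0
  · obtain ⟨i, hip, hi⟩ := h
    refine ⟨i, fun k hk => ?_, Or.inl ⟨p, if_neg hip.symm, hpx.symm⟩⟩
    exact if_neg fun hki : k = i => hi (hki ▸ hk)
  · push Not at h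
    refine ⟨p, ?_⟩
    rw [← hx.eq_ite_of_forall_ne h]
    exact LowMinus.refl x

/-- `⊑L−` is an information ordering on `Δⁿ`: it is permutation invariant, allows mixing,
has the uniform distribution as least element, and every element lies below some pointed
distribution `⊤ᵢ`, each of which is maximal. -/
theorem lowMinus_informationOrdering (n : ℕ) (hn : 2 ≤ n) :
    -- (i) permutation invariance
    (∀ x y : Fin n → ℝ, IsDist x → IsDist y → ∀ σ : Equiv.Perm (Fin n),
      LowMinus x y → LowMinus (x ∘ σ) (y ∘ σ)) ∧
    -- (ii) mixing
    (∀ x y : Fin n → ℝ, IsDist x → IsDist y → LowMinus x y → ∀ t ∈ Set.Icc (0:ℝ) 1,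
      LowMinus x (fun k => (1 - t) * x k + t * y k) ∧
      LowMinus (fun k => (1 - t) * x k + t * y k) y) ∧
    -- (iii) the uniform distribution is below everything
    (∀ x : Fin n → ℝ, IsDist x → LowMinus (fun _ => (1 : ℝ) / n) x) ∧
    -- (iv) every element is below some pointed distribution, and each ⊤ᵢ is maximal
    (∀ x : Fin n → ℝ, IsDist x →
      ∃ i : Fin n, LowMinus x (fun k => if k = i then (1 : ℝ) else 0)) ∧
    (∀ (i : Fin n) (y : Fin n → ℝ), IsDist y →
      LowMinus (fun k => if k = i then (1 : ℝ) else 0) y →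
      y = fun k => if k = i then (1 : ℝ) else 0) := by
  have hpos : (0 : ℝ) < 1 / n := by
    have : 0 < n := by omega
    positivity
  refine ⟨fun x y _ _ σ h => h.comp_perm σ, fun x y hx hy h t ht => h.mix hx hy ht,
    fun x hx => lowMinus_const hpos hx, fun x hx => hx.exists_lowMinus_ite, ?_⟩
  intro i y hy h
  exact hy.eq_ite_of_forall_ne fun j hj => h.1 (if_neg hj)
end

section
/- If x ⊑L− y then Z(x) ≤ Z(y); if moreover Z(x) = Z(y) then x⁻ ≥ y⁻; and if in addition x⁻ = y⁻ then x = y. Consequently μ−(x) = (2n − 3 − 2Z(x)) + x⁻ is a measurement for ⊑L−, i.e. a strictly monotone map into [0,∞) with the reversed order: x ⊑L− y implies μ−(x) ≥ μ−(y), and x ⊑L− y together with μ−(x) = μ−(y) implies x = y. -/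
/-- `Z(x)`, the number of zero coordinates of `x`. -/
noncomputable def zeros {n : ℕ} (x : Fin n → ℝ) : ℕ :=
  Set.ncard {k | x k = 0}

section

variable {n : ℕ} {x y : Fin n → ℝ}

/-- The smallest nonzero coordinate is attained. -/
theorem IsDist.exists_eq_minPos (hx : IsDist x) : ∃ k, x k = minPos x ∧ x k ≠ 0 := by
  have hfin : {a : ℝ | (∃ k, x k = a) ∧ a ≠ 0}.Finite :=
    (Set.finite_range x).subset fun _ h => h.1
  have hne : {a : ℝ | (∃ k, x k = a) ∧ a ≠ 0}.Nonempty := by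
    obtain ⟨k, -, hk⟩ := Finset.exists_ne_zero_of_sum_ne_zero (hx.2.trans_ne one_ne_zero)
    exact ⟨x k, ⟨k, rfl⟩, hk⟩
  obtain ⟨⟨k, hk⟩, h0⟩ := hne.csInf_mem hfin
  exact ⟨k, hk, hk.trans_ne h0⟩

theorem IsDist.minPos_pos (hx : IsDist x) : 0 < minPos x := by
  obtain ⟨k, hk, h0⟩ := hx.exists_eq_minPos
  exact hk ▸ (hx.1 k).lt_of_ne' h0

theorem IsDist.minPos_le_one (hx : IsDist x) : minPos x ≤ 1 := by
  obtain ⟨k, hk, -⟩ := hx.exists_eq_minPos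
  rw [← hk, ← hx.2]
  exact Finset.single_le_sum (fun i _ => hx.1 i) (Finset.mem_univ k)

theorem LowMinus.zeros_le (h : LowMinus x y) : zeros x ≤ zeros y :=
  Set.ncard_le_ncard h.1

theorem LowMinus.mul_minPos_le (hx : IsDist x) (h : LowMinus x y) (hz : zeros x = zeros y)
    (k : Fin n) : x k * minPos y ≤ y k * minPos x := by
  have heq : {k | x k = 0} = {k | y k = 0} := Set.eq_of_subset_of_ncard_le h.1 hz.ge
  obtain ⟨j, hyj, hxj⟩ | ⟨-, hle⟩ := h.2
  · have hj : x j = 0 := heq.ge hyj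
    exact absurd (hxj.symm.trans hj) hx.minPos_pos.ne'
  · by_cases hk : x k = 0
    · have hyk : y k = 0 := heq.le hk
      simp [hk, hyk]
    · exact hle k hk

theorem LowMinus.minPos_le (hx : IsDist x) (hy : IsDist y) (h : LowMinus x y)
    (hz : zeros x = zeros y) : minPos y ≤ minPos x := by
  have hsum := Finset.sum_le_sum fun k (_ : k ∈ Finset.univ) => h.mul_minPos_le hx hz k
  rwa [← Finset.sum_mul, ← Finset.sum_mul, hx.2, hy.2, one_mul, one_mul] at hsum

theorem LowMinus.eq_of_minPos_eq (hx : IsDist x) (hy : IsDist y) (h : LowMinus x y)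
    (hz : zeros x = zeros y) (hm : minPos x = minPos y) : x = y := by
  have hle : ∀ k ∈ Finset.univ, x k ≤ y k := fun k _ =>
    le_of_mul_le_mul_right (hm ▸ h.mul_minPos_le hx hz k) hy.minPos_pos
  funext k
  exact (Finset.sum_eq_sum_iff_of_le hle).1 (hx.2.trans hy.2.symm) k (Finset.mem_univ k)

/-- A change in the number of zeros outweighs any change in the smallest nonzero coordinate. -/
theorem two_mul_zeros_add_minPos_lt (hx : IsDist x) (hy : IsDist y) (hz : zeros x < zeros y) :
    2 * (zeros x : ℝ) + minPos y < 2 * (zeros y : ℝ) + minPos x := by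
  have hz' : (zeros x : ℝ) + 1 ≤ zeros y := by exact_mod_cast hz
  linarith [hx.minPos_pos, hy.minPos_le_one]

end

/-- If `x ⊑L− y` then `Z(x) ≤ Z(y)`; if moreover `Z(x) = Z(y)` then `x⁻ ≥ y⁻`; and if in
addition `x⁻ = y⁻` then `x = y`.  Consequently `μ₋(x) = (2n − 3 − 2Z(x)) + x⁻` is a
measurement for `⊑L−`: it is monotone into the reversed order and strict. -/
theorem muMinus_measurement (n : ℕ) (hn : 2 ≤ n) :
    (∀ x y : Fin n → ℝ, IsDist x → IsDist y → LowMinus x y →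
      zeros x ≤ zeros y ∧
      (zeros x = zeros y → minPos y ≤ minPos x ∧ (minPos x = minPos y → x = y))) ∧
    (∀ x y : Fin n → ℝ, IsDist x → IsDist y → LowMinus x y →
      (2 * (n : ℝ) - 3 - 2 * (zeros y : ℝ)) + minPos y ≤
        (2 * (n : ℝ) - 3 - 2 * (zeros x : ℝ)) + minPos x) ∧
    (∀ x y : Fin n → ℝ, IsDist x → IsDist y → LowMinus x y →
      (2 * (n : ℝ) - 3 - 2 * (zeros x : ℝ)) + minPos x =
        (2 * (n : ℝ) - 3 - 2 * (zeros y : ℝ)) + minPos y → x = y) := by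
  refine ⟨fun x y hx hy h => ⟨h.zeros_le, fun hz => ⟨h.minPos_le hx hy hz,
    h.eq_of_minPos_eq hx hy hz⟩⟩, fun x y hx hy h => ?_, fun x y hx hy h he => ?_⟩
  · obtain hz | hz := h.zeros_le.lt_or_eq
    · linarith [two_mul_zeros_add_minPos_lt hx hy hz]
    · rw [hz]
      linarith [h.minPos_le hx hy hz]
  · obtain hz | hz := h.zeros_le.lt_or_eq
    · linarith [two_mul_zeros_add_minPos_lt hx hy hz]
    · rw [hz] at he
      exact h.eq_of_minPos_eq hx hy hz (add_left_cancel he)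
end
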